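/- Let P₁, P₂, P₃ ∈ ℙ²(k̄) be three distinct points fixed by σ (points of degree 1), and set X = ℙ²(k̄) \ {P₁, P₂, P₃}. Then for every n > 0, the number of n-element subsets S ⊆ X with σ(S) = S equals ((q − 1)/(q² + 1)²) · [ (q³ + 2q² + 2q + 1) q^{2n} + (−1)^n ( (n−1) q³ − (n+2) q² + (n−2) q − (n+1) ) ]. -/

import Mathlib

/-- The `q`-power Frobenius acting on `ℙ^{m-1}(k̄)` (raising homogeneous
coordinates to the `q`-th power), where `q = |k|`. -/
noncomputable def projFrob (k : Type*) [Field k] [Fintype k] (m : ℕ) :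
    Projectivization (AlgebraicClosure k) (Fin m → AlgebraicClosure k) →
    Projectivization (AlgebraicClosure k) (Fin m → AlgebraicClosure k) :=
  fun P => Projectivization.mk (AlgebraicClosure k)
    (fun i => (P.rep i) ^ (Fintype.card k)) (by
      intro h
      apply P.rep_nonzero
      funext i
      have hi : P.rep i ^ (Fintype.card k) = 0 := by simpa using congrFun h i
      simpa using pow_eq_zero_iff (Fintype.card_ne_zero (α := k)) |>.mp hi)

/-- The number of `n`-element subsets `S` of `A ⊆ X` with `σ(S) = S`. -/
noncomputable def nSetCount {X : Type*} (σ : X → X) (A : Set X) (n : ℕ) : ℕ :=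
  Set.ncard {S : Set X | S ⊆ A ∧ S.Finite ∧ S.ncard = n ∧ σ '' S = S}

open Polynomial in
lemma frob_roots (k : Type*) [Field k] [Fintype k] (m : ℕ) (hm : 0 < m) :
    Set.ncard {a : AlgebraicClosure k | a ^ (Fintype.card k ^ m) = a} = Fintype.card k ^ m := by
  classical
  set Q := Fintype.card k ^ m with hQ
  obtain ⟨p, hp⟩ := CharP.exists k
  have : CharP (AlgebraicClosure k) p := charP_of_injective_algebraMap (algebraMap k (AlgebraicClosure k)).injective p
  have hpd : p ∣ Fintype.card k := by
    rw [← CharP.cast_eq_zero_iff k p]; exact Nat.cast_card_eq_zero k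
  have h1 : 1 < Fintype.card k := Fintype.one_lt_card
  have hQ1 : 1 < Q := Nat.one_lt_pow hm.ne' h1
  have hsep : (X ^ Q - X : (AlgebraicClosure k)[X]).Separable := galois_poly_separable p Q (hpd.trans (dvd_pow_self _ hm.ne'))
  have hdeg : (X ^ Q - X : (AlgebraicClosure k)[X]).natDegree = Q := FiniteField.X_pow_card_sub_X_natDegree_eq (AlgebraicClosure k) hQ1
  have hne : (X ^ Q - X : (AlgebraicClosure k)[X]) ≠ 0 := FiniteField.X_pow_card_sub_X_ne_zero (AlgebraicClosure k) hQ1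
  have := Polynomial.card_rootSet_eq_natDegree (K := AlgebraicClosure k) hsep (IsAlgClosed.splits _)
  rw [hdeg] at this
  refine Eq.trans ?_ this
  rw [← Nat.card_eq_fintype_card, Nat.card_coe_set_eq]
  congr 1
  ext a
  simp [Polynomial.mem_rootSet, hne, sub_eq_zero]

lemma projFrob_mk (k : Type*) [Field k] [Fintype k] (m : ℕ) (v : Fin m → AlgebraicClosure k) (hv : v ≠ 0)
    (hv' : (fun i => v i ^ Fintype.card k) ≠ 0) :
    projFrob k m (Projectivization.mk _ v hv) = Projectivization.mk _ (fun i => v i ^ Fintype.card k) hv' := by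
  unfold projFrob
  rw [Projectivization.mk_eq_mk_iff']
  obtain ⟨a, ha⟩ := Projectivization.exists_smul_eq_mk_rep (AlgebraicClosure k) v hv
  refine ⟨(a : AlgebraicClosure k) ^ Fintype.card k, ?_⟩
  ext i
  rw [← ha]
  simp [mul_pow, Units.smul_def]

lemma pow_fun_ne {K : Type*} [Field K] {m : ℕ} {v : Fin m → K} (hv : v ≠ 0) (Q : ℕ) :
    (fun i => v i ^ Q) ≠ 0 := by
  intro h
  apply hv
  funext i
  have := congrFun h i
  simp only [Pi.zero_apply] at this
  exact eq_zero_of_pow_eq_zero this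

lemma projFrob_iter (k : Type*) [Field k] [Fintype k] (m j : ℕ) (v : Fin m → AlgebraicClosure k) (hv : v ≠ 0) :
    (projFrob k m)^[j] (Projectivization.mk _ v hv) =
      Projectivization.mk _ (fun i => v i ^ (Fintype.card k ^ j)) (pow_fun_ne hv _) := by
  induction j with
  | zero => simp
  | succ j ih =>
    rw [Function.iterate_succ_apply', ih, projFrob_mk _ _ _ _ (pow_fun_ne (pow_fun_ne hv _) _)]
    congr 1
    funext i
    rw [← pow_mul, pow_succ]

lemma fix_count (k : Type*) [Field k] [Fintype k] (m : ℕ) (hm : 0 < m) :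
    {P | Function.IsPeriodicPt (projFrob k 3) m P}.Finite ∧
    Set.ncard {P | Function.IsPeriodicPt (projFrob k 3) m P} =
      (Fintype.card k ^ m) ^ 2 + Fintype.card k ^ m + 1 := by
  classical
  have hR := frob_roots k m hm
  have h1 : 1 < Fintype.card k := Fintype.one_lt_card
  have hfix : ∀ (v : Fin 3 → (AlgebraicClosure k)) (hv : v ≠ 0),
      Function.IsPeriodicPt (projFrob k 3) m (Projectivization.mk _ v hv) ↔
      ∃ a : (AlgebraicClosure k), a • v = fun i => v i ^ (Fintype.card k ^ m) := by
    intro v hv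
    rw [Function.IsPeriodicPt, Function.IsFixedPt, projFrob_iter, Projectivization.mk_eq_mk_iff']
  set Q := Fintype.card k ^ m with hQ
  have hQ1 : 1 < Q := Nat.one_lt_pow hm.ne' h1
  have hQ0 : Q ≠ 0 := by omega
  set R := {a : (AlgebraicClosure k) | a ^ Q = a} with hRdef
  have hRf : R.Finite := Set.finite_of_ncard_pos (by omega)
  have n1 : ∀ a b : (AlgebraicClosure k), (![1, a, b] : Fin 3 → (AlgebraicClosure k)) ≠ 0 := fun a b h => by simpa using congrFun h 0
  have n2 : ∀ a : (AlgebraicClosure k), (![0, 1, a] : Fin 3 → (AlgebraicClosure k)) ≠ 0 := fun a h => by simpa using congrFun h 1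
  have n3 : (![0, 0, 1] : Fin 3 → (AlgebraicClosure k)) ≠ 0 := fun h => by simpa using congrFun h 2
  let f1 : (AlgebraicClosure k) × (AlgebraicClosure k) → Projectivization (AlgebraicClosure k) (Fin 3 → (AlgebraicClosure k)) := fun p => Projectivization.mk _ _ (n1 p.1 p.2)
  let f2 : (AlgebraicClosure k) → Projectivization (AlgebraicClosure k) (Fin 3 → (AlgebraicClosure k)) := fun p => Projectivization.mk _ _ (n2 p)
  let f3 : Projectivization (AlgebraicClosure k) (Fin 3 → (AlgebraicClosure k)) := Projectivization.mk _ _ n3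
  have i1 : Function.Injective f1 := by
    rintro ⟨a, b⟩ ⟨c, d⟩ h
    obtain ⟨t, ht⟩ := (Projectivization.mk_eq_mk_iff' _ _ _ _ _).1 h
    have e0 := congrFun ht 0
    have e1 := congrFun ht 1
    have e2 := congrFun ht 2
    simp at e0 e1 e2
    subst e0
    simp at e1 e2
    simp [e1, e2]
  have i2 : Function.Injective f2 := by
    rintro a c h
    obtain ⟨t, ht⟩ := (Projectivization.mk_eq_mk_iff' _ _ _ _ _).1 h
    have e1 := congrFun ht 1
    have e2 := congrFun ht 2
    simp at e1 e2
    subst e1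
    simp at e2
    simp [e2]
  have d12 : ∀ p a, f1 p ≠ f2 a := by
    rintro p a h
    obtain ⟨t, ht⟩ := (Projectivization.mk_eq_mk_iff' _ _ _ _ _).1 h
    have e0 := congrFun ht 0
    simp at e0
  have d13 : ∀ p, f1 p ≠ f3 := by
    rintro p h
    obtain ⟨t, ht⟩ := (Projectivization.mk_eq_mk_iff' _ _ _ _ _).1 h
    have e0 := congrFun ht 0
    simp at e0
  have d23 : ∀ p, f2 p ≠ f3 := by
    rintro p h
    obtain ⟨t, ht⟩ := (Projectivization.mk_eq_mk_iff' _ _ _ _ _).1 h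
    have e0 := congrFun ht 1
    simp at e0
  have key : {P | Function.IsPeriodicPt (projFrob k 3) m P} =
      (f1 '' (R ×ˢ R) ∪ f2 '' R) ∪ {f3} := by
    have k1 : ∀ a b, Function.IsPeriodicPt (projFrob k 3) m (f1 (a, b)) ↔ a ∈ R ∧ b ∈ R := by
      intro a b
      rw [hfix]
      constructor
      · rintro ⟨t, ht⟩
        have e0 := congrFun ht 0
        have e1 := congrFun ht 1
        have e2 := congrFun ht 2
        simp at e0 e1 e2
        subst e0
        simp at e1 e2
        exact ⟨e1.symm, e2.symm⟩
      · rintro ⟨ha, hb⟩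
        refine ⟨1, ?_⟩
        funext i
        simp only [hRdef, Set.mem_ofPred_eq] at ha hb
        fin_cases i <;> simp [ha, hb]
    have k2 : ∀ a, Function.IsPeriodicPt (projFrob k 3) m (f2 a) ↔ a ∈ R := by
      intro a
      rw [hfix]
      constructor
      · rintro ⟨t, ht⟩
        have e1 := congrFun ht 1
        have e2 := congrFun ht 2
        simp at e1 e2
        subst e1
        simp at e2
        exact e2.symm
      · rintro ha
        refine ⟨1, ?_⟩
        funext i
        simp only [hRdef, Set.mem_ofPred_eq] at ha
        fin_cases i <;> simp [ha, hQ0]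
    have k3 : Function.IsPeriodicPt (projFrob k 3) m f3 := by
      rw [hfix]
      refine ⟨1, ?_⟩
      funext i
      fin_cases i <;> simp [hQ0]
    have cover : ∀ P, (∃ a b, P = f1 (a, b)) ∨ (∃ a, P = f2 a) ∨ P = f3 := by
      intro P
      induction P using Projectivization.ind with
      | h v hv =>
      by_cases h0 : v 0 = 0
      · by_cases h1 : v 1 = 0
        · by_cases h2 : v 2 = 0
          · exact absurd (by funext i; fin_cases i <;> simp [h0, h1, h2]) hv
          · right; right
            refine (Projectivization.mk_eq_mk_iff' _ _ _ _ _).2 ⟨v 2, ?_⟩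
            funext i; fin_cases i <;> simp [h0, h1]
        · right; left
          refine ⟨v 2 / v 1, (Projectivization.mk_eq_mk_iff' _ _ _ _ _).2 ⟨v 1, ?_⟩⟩
          funext i; fin_cases i <;> simp [h0]
          field_simp
      · left
        refine ⟨v 1 / v 0, v 2 / v 0, (Projectivization.mk_eq_mk_iff' _ _ _ _ _).2 ⟨v 0, ?_⟩⟩
        funext i; fin_cases i <;> simp <;> field_simp
    ext P
    simp only [Set.mem_ofPred_eq, Set.mem_union, Set.mem_image, Set.mem_prod, Set.mem_singleton_iff]
    constructor
    · intro h
      rcases cover P with ⟨a, b, rfl⟩ | ⟨a, rfl⟩ | rfl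
      · exact Or.inl (Or.inl ⟨(a, b), (k1 a b).1 h, rfl⟩)
      · exact Or.inl (Or.inr ⟨a, (k2 a).1 h, rfl⟩)
      · exact Or.inr rfl
    · rintro ((⟨⟨a, b⟩, h, rfl⟩ | ⟨a, h, rfl⟩) | rfl)
      · exact (k1 a b).2 h
      · exact (k2 a).2 h
      · exact k3
  have fi1 : (f1 '' (R ×ˢ R)).Finite := (hRf.prod hRf).image _
  have fi2 : (f2 '' R).Finite := hRf.image _
  rw [key]
  refine ⟨(fi1.union fi2).union (Set.finite_singleton _), ?_⟩
  rw [Set.ncard_union_eq _ (fi1.union fi2) (Set.finite_singleton _), Set.ncard_union_eq _ fi1 fi2,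
    Set.ncard_image_of_injective _ i1, Set.ncard_image_of_injective _ i2, Set.ncard_prod, hR,
    Set.ncard_singleton, sq]
  · rw [Set.disjoint_left]
    rintro _ ⟨p, -, rfl⟩ ⟨a, -, h⟩
    exact d12 _ _ h.symm
  · rw [Set.disjoint_left]
    rintro _ (⟨p, -, rfl⟩ | ⟨p, -, rfl⟩) h
    · exact d13 _ h
    · exact d23 _ h

/-- stable subsets of `U` of size `n`. -/
noncomputable def stabF {X : Type*} [DecidableEq X] (σ : X → X) (U : Finset X) (n : ℕ) :
    Finset (Finset X) :=
  U.powerset.filter (fun S => S.card = n ∧ S.image σ = S)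

lemma stab_iter {X : Type*} [DecidableEq X] {σ : X → X} {S : Finset X} (h : S.image σ = S) {x : X}
    (hx : x ∈ S) (i : ℕ) : σ^[i] x ∈ S := by
  induction i with
  | zero => simpa
  | succ i ih =>
    rw [Function.iterate_succ_apply', ← h]
    exact Finset.mem_image_of_mem _ ih

/-- The orbit as a finset. -/
noncomputable def orbF {X : Type*} [DecidableEq X] (σ : X → X) (x : X) : Finset X :=
  (Finset.range (Function.minimalPeriod σ x)).image (fun i => σ^[i] x)

lemma orbF_card {X : Type*} [DecidableEq X] (σ : X → X) (x : X) :
    (orbF σ x).card = Function.minimalPeriod σ x := by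
  unfold orbF
  rw [Finset.card_image_of_injOn, Finset.card_range]
  have := Function.iterate_injOn_Iio_minimalPeriod (f := σ) (x := x)
  intro a ha b hb h
  exact this (by simpa using ha) (by simpa using hb) h

lemma orbF_iter {X : Type*} [DecidableEq X] {σ : X → X} {x : X} (hx : x ∈ Function.periodicPts σ)
    (i : ℕ) : σ^[i] x ∈ orbF σ x := by
  unfold orbF
  refine Finset.mem_image.2 ⟨i % Function.minimalPeriod σ x, ?_, Function.iterate_mod_minimalPeriod_eq⟩
  simpa using Nat.mod_lt _ (Function.minimalPeriod_pos_of_mem_periodicPts hx)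

lemma mem_orbF {X : Type*} [DecidableEq X] {σ : X → X} {x y : X} (h : y ∈ orbF σ x) :
    ∃ i, i < Function.minimalPeriod σ x ∧ σ^[i] x = y := by
  unfold orbF at h
  simpa using h

lemma orbF_back {X : Type*} [DecidableEq X] {σ : X → X} {x y : X} (hx : x ∈ Function.periodicPts σ)
    (h : y ∈ orbF σ x) : x ∈ orbF σ y ∧ ∃ j, σ^[j] y = x := by
  obtain ⟨i, hi, rfl⟩ := mem_orbF h
  have : σ^[Function.minimalPeriod σ x - i] (σ^[i] x) = x := by
    rw [← Function.iterate_add_apply, Nat.sub_add_cancel hi.le, Function.iterate_minimalPeriod]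
  refine ⟨?_, _, this⟩
  have hp : σ^[i] x ∈ Function.periodicPts σ := by
    obtain ⟨m, hm, h⟩ := hx
    exact ⟨m, hm, h.apply_iterate i⟩
  have h2 := orbF_iter hp (Function.minimalPeriod σ x - i)
  rwa [this] at h2

lemma orbF_image {X : Type*} [DecidableEq X] {σ : X → X} {x : X} (hx : x ∈ Function.periodicPts σ) :
    (orbF σ x).image σ = orbF σ x := by
  apply Finset.eq_of_subset_of_card_le
  · intro y hy
    obtain ⟨z, hz, rfl⟩ := Finset.mem_image.1 hy
    obtain ⟨i, hi, rfl⟩ := mem_orbF hz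
    rw [← Function.iterate_succ_apply' σ]
    exact orbF_iter hx _
  · have hinj : Set.InjOn σ (Function.periodicPts σ) := (Function.bijOn_periodicPts σ).injOn
    rw [Finset.card_image_of_injOn]
    refine hinj.mono ?_
    intro y hy
    obtain ⟨i, hi, rfl⟩ := mem_orbF (by simpa using hy)
    obtain ⟨m, hm, h⟩ := hx
    exact ⟨m, hm, h.apply_iterate i⟩

lemma stab_shift {X : Type*} [DecidableEq X] (σ : X → X) (U : Finset X)
    (hU : ∀ x ∈ U, σ x ∈ U) (hper : ∀ x ∈ U, x ∈ Function.periodicPts σ) {x : X} (hx : x ∈ U) (n : ℕ) :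
    ((stabF σ U (n + Function.minimalPeriod σ x)).filter (fun S => x ∈ S)).card =
      ((stabF σ U n).filter (fun S => x ∉ S)).card := by
  have hxp := hper x hx
  have hinj : Set.InjOn σ (Function.periodicPts σ) := (Function.bijOn_periodicPts σ).injOn
  have hxO : x ∈ orbF σ x := orbF_iter hxp 0
  have hOU : orbF σ x ⊆ U := by
    intro y hy
    obtain ⟨i, hi, rfl⟩ := mem_orbF hy
    clear hi hy
    induction i with
    | zero => simpa
    | succ i ih => rw [Function.iterate_succ_apply']; exact hU _ ih
  have hdisj : ∀ S : Finset X, S.image σ = S → x ∉ S → Disjoint S (orbF σ x) := by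
    intro S hS hxS
    rw [Finset.disjoint_left]
    intro y hy hyO
    obtain ⟨-, j, hj⟩ := orbF_back hxp hyO
    exact hxS (hj ▸ stab_iter hS hy j)
  have hsub : ∀ S : Finset X, S.image σ = S → x ∈ S → orbF σ x ⊆ S := by
    intro S hS hxS y hy
    obtain ⟨i, hi, rfl⟩ := mem_orbF hy
    exact stab_iter hS hxS i
  refine Finset.card_nbij' (fun S => S \ orbF σ x) (fun S => S ∪ orbF σ x) ?_ ?_ ?_ ?_
  · intro S hS
    simp only [stabF, Finset.coe_filter, Finset.mem_filter, Finset.mem_powerset, Set.mem_ofPred_eq] at hS ⊢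
    obtain ⟨⟨h1, h2, h3⟩, h4⟩ := hS
    refine ⟨⟨Finset.sdiff_subset.trans h1, ?_, ?_⟩, by simp [hxO]⟩
    · rw [Finset.card_sdiff_of_subset (hsub S h3 h4), h2, orbF_card]; omega
    · rw [Finset.image_sdiff_of_injOn (hinj.mono fun y hy => hper y (h1 hy)) (hsub S h3 h4), h3, orbF_image hxp]
  · intro S hS
    simp only [stabF, Finset.coe_filter, Finset.mem_filter, Finset.mem_powerset, Set.mem_ofPred_eq] at hS ⊢
    obtain ⟨⟨h1, h2, h3⟩, h4⟩ := hS
    refine ⟨⟨Finset.union_subset h1 hOU, ?_, ?_⟩, by simp [hxO]⟩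
    · rw [Finset.card_union_of_disjoint (hdisj S h3 h4), h2, orbF_card]
    · rw [Finset.image_union, h3, orbF_image hxp]
  · intro S hS
    simp only [stabF, Finset.coe_filter, Finset.mem_filter, Finset.mem_powerset, Set.mem_ofPred_eq] at hS
    exact Finset.sdiff_union_of_subset (hsub S hS.1.2.2 hS.2)
  · intro S hS
    simp only [stabF, Finset.coe_filter, Finset.mem_filter, Finset.mem_powerset, Set.mem_ofPred_eq] at hS
    exact Finset.union_sdiff_cancel_right (hdisj S hS.1.2.2 hS.2)

lemma stab_small {X : Type*} [DecidableEq X] (σ : X → X) (U : Finset X) {x : X} (n : ℕ)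
    (h : n < Function.minimalPeriod σ x) :
    ((stabF σ U n).filter (fun S => x ∈ S)).card = 0 := by
  rw [Finset.card_eq_zero, Finset.filter_eq_empty_iff]
  intro S hS hxS
  simp only [stabF, Finset.mem_filter, Finset.mem_powerset] at hS
  obtain ⟨h1, h2, h3⟩ := hS
  have : orbF σ x ⊆ S := by
    intro y hy
    obtain ⟨i, hi, rfl⟩ := mem_orbF hy
    exact stab_iter h3 hxS i
  have := Finset.card_le_card this
  rw [orbF_card] at this
  omega

lemma stab_split {X : Type*} [DecidableEq X] (σ : X → X) (U : Finset X) (x : X) (n : ℕ) :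
    (stabF σ U n).card = ((stabF σ U n).filter (fun S => x ∈ S)).card
      + ((stabF σ U n).filter (fun S => x ∉ S)).card :=
  (Finset.card_filter_add_card_filter_not _).symm

lemma stab_double {X : Type*} [DecidableEq X] (σ : X → X) (U : Finset X) (n : ℕ) :
    (stabF σ U n).card * n = ∑ x ∈ U, ((stabF σ U n).filter (fun S => x ∈ S)).card := by
  have := Finset.sum_card_bipartiteAbove_eq_sum_card_bipartiteBelow (s := U) (t := stabF σ U n)
    (fun (x : X) (S : Finset X) => x ∈ S)
  unfold Finset.bipartiteAbove Finset.bipartiteBelow at this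
  rw [this, Finset.sum_const_nat]
  intro S hS
  simp only [stabF, Finset.mem_filter, Finset.mem_powerset] at hS
  rw [Finset.filter_mem_eq_inter, Finset.inter_eq_right.2 hS.1, hS.2.1]

open PowerSeries in
/-- `∑_{d ∣ m, m > 0} (-1)^(m/d-1) t^m`. -/
noncomputable def Eser (d : ℕ) : PowerSeries ℚ :=
  PowerSeries.mk fun m => if m ≠ 0 ∧ d ∣ m then (-1) ^ (m / d + 1) else 0

open PowerSeries in
lemma Eser_mul (d : ℕ) (hd : 0 < d) : Eser d * (1 + X ^ d) = X ^ d := by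
  ext m
  rw [mul_add, mul_one, mul_comm _ (X ^ d), map_add, coeff_X_pow_mul', coeff_X_pow]
  simp only [Eser, coeff_mk]
  by_cases hdm : d ≤ m
  · obtain ⟨r, rfl⟩ := Nat.exists_eq_add_of_le hdm
    have h2 : (d + r) / d = r / d + 1 := Nat.add_div_left r hd
    simp only [hdm, if_true, Nat.add_sub_cancel_left, h2]
    by_cases hr : r = 0
    · subst hr; simp [hd.ne']
    · by_cases hdr : d ∣ r
      · simp [hr, hdr, hd.ne', pow_succ]
      · simp [hr, hdr]
  · have h1 : ¬ (m ≠ 0 ∧ d ∣ m) := fun h => hdm (Nat.le_of_dvd (by omega) h.2)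
    have h2 : m ≠ d := by omega
    simp [hdm, h1, h2]

open PowerSeries in
lemma stab_series {X : Type*} [DecidableEq X] (σ : X → X) (U : Finset X)
    (hU : ∀ x ∈ U, σ x ∈ U) (hper : ∀ x ∈ U, x ∈ Function.periodicPts σ) (A : PowerSeries ℚ)
    (hA : A = PowerSeries.mk fun n => ((stabF σ U n).card : ℚ)) :
    PowerSeries.X * derivative ℚ A = (∑ x ∈ U, Eser (Function.minimalPeriod σ x)) * A := by
  have key : ∀ x ∈ U, (PowerSeries.mk fun n => (((stabF σ U n).filter (fun S => x ∈ S)).card : ℚ))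
      = Eser (Function.minimalPeriod σ x) * A := by
    intro x hx
    set d := Function.minimalPeriod σ x with hd
    have hd0 : 0 < d := Function.minimalPeriod_pos_of_mem_periodicPts (hper x hx)
    set A1 : PowerSeries ℚ := PowerSeries.mk fun n => (((stabF σ U n).filter (fun S => x ∈ S)).card : ℚ)
      with hA1
    set A2 : PowerSeries ℚ := PowerSeries.mk fun n => (((stabF σ U n).filter (fun S => x ∉ S)).card : ℚ)
      with hA2
    have e1 : A = A1 + A2 := by
      ext n
      rw [hA, hA1, hA2, map_add, coeff_mk, coeff_mk, coeff_mk, stab_split σ U x n]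
      push_cast; rfl
    have e2 : A1 = PowerSeries.X ^ d * A2 := by
      ext n
      rw [coeff_X_pow_mul', hA1, hA2, coeff_mk, coeff_mk]
      split_ifs with h
      · obtain ⟨r, rfl⟩ := Nat.exists_eq_add_of_le h
        rw [Nat.add_sub_cancel_left, add_comm d r, hd, stab_shift σ U hU hper hx]
      · rw [stab_small σ U n (by omega)]; simp
    have e3 := Eser_mul d hd0
    have hne : (1 + PowerSeries.X ^ d : PowerSeries ℚ) ≠ 0 := by
      intro h
      have := congrArg (coeff 0) h
      simp [hd0.ne'] at this
    apply mul_right_cancel₀ hne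
    rw [mul_right_comm, e3, e1]
    linear_combination e2
  rw [Finset.sum_mul, ← Finset.sum_congr rfl key]
  ext n
  rw [map_sum]
  simp only [coeff_mk]
  have := stab_double σ U n
  have h2 : (∑ x ∈ U, (((stabF σ U n).filter (fun S => x ∈ S)).card : ℚ)) = (stabF σ U n).card * n := by
    exact_mod_cast this.symm
  rw [h2]
  cases n with
  | zero => simp
  | succ n =>
    rw [coeff_succ_X_mul, coeff_derivative, hA, coeff_mk]; push_cast; ring

open PowerSeries in
lemma Eser_sum {X : Type*} [DecidableEq X] (σ : X → X) (U : Finset X)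
    (N : ℕ → ℚ) (m : ℕ) (hm : 0 < m)
    (hN : ∀ j, 0 < j → j ≤ m → ((U.filter (fun x => Function.minimalPeriod σ x ∣ j)).card : ℚ) = N j) :
    coeff m (∑ x ∈ U, Eser (Function.minimalPeriod σ x)) =
      N m - if 2 ∣ m then 2 * N (m / 2) else 0 := by
  rw [map_sum]
  simp only [Eser, coeff_mk]
  have hpt : ∀ x ∈ U, (if m ≠ 0 ∧ Function.minimalPeriod σ x ∣ m then
      (-1 : ℚ) ^ (m / Function.minimalPeriod σ x + 1) else 0) =
      (if Function.minimalPeriod σ x ∣ m then 1 else 0) -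
        if 2 ∣ m then 2 * (if Function.minimalPeriod σ x ∣ m / 2 then 1 else 0) else 0 := by
    intro x hx
    generalize Function.minimalPeriod σ x = d
    by_cases hd : d ∣ m
    · obtain ⟨e, rfl⟩ := hd
      have hd0 : 0 < d := Nat.pos_of_mul_pos_right hm
      rw [Nat.mul_div_cancel_left _ hd0]
      rcases Nat.even_or_odd e with he | he
      · obtain ⟨f, rfl⟩ := he
        have h2 : d * (f + f) / 2 = d * f := by
          rw [← two_mul, Nat.mul_left_comm, Nat.mul_div_cancel_left _ two_pos]
        have h3 : 2 ∣ d * (f + f) := ⟨d * f, by ring⟩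
        rw [h2, if_pos h3, if_pos ⟨hm.ne', dvd_mul_right _ _⟩, if_pos (dvd_mul_right _ _), if_pos (dvd_mul_right _ _),
          Odd.neg_one_pow ⟨f, by ring⟩]
        norm_num
      · rw [if_pos ⟨hm.ne', dvd_mul_right _ _⟩, if_pos (dvd_mul_right _ _), Even.neg_one_pow he.add_one]
        split_ifs with h3 h4
        · exfalso
          obtain ⟨g, hg⟩ := h3
          rw [hg, Nat.mul_div_cancel_left _ two_pos] at h4
          obtain ⟨f, rfl⟩ := h4
          have : e = 2 * f := by
            apply Nat.eq_of_mul_eq_mul_left hd0; rw [hg]; ring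
          rw [this] at he
          exact (Nat.not_odd_iff_even.2 (even_two_mul f)) he
        · norm_num
        · norm_num
    · have h4 : 2 ∣ m → ¬ d ∣ m / 2 := by
        rintro ⟨g, rfl⟩ h
        rw [Nat.mul_div_cancel_left _ two_pos] at h
        exact hd (h.mul_left 2)
      by_cases h2 : 2 ∣ m
      · simp [hd, h4 h2]
      · simp [hd, h2]
  rw [Finset.sum_congr rfl hpt, Finset.sum_sub_distrib, Finset.sum_boole, hN m hm le_rfl]
  by_cases h2 : 2 ∣ m
  · simp only [h2, if_true]
    rw [← Finset.mul_sum, Finset.sum_boole, hN (m / 2) (by omega) (by omega)]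
  · simp [h2]

open PowerSeries in
lemma series_unique (A B C D : PowerSeries ℚ) (n : ℕ) (h0 : coeff 0 A = coeff 0 B)
    (hA : X * derivative ℚ A = C * A) (hB : X * derivative ℚ B = D * B)
    (hCD : ∀ m ≤ n, coeff m C = coeff m D) (hC0 : coeff 0 C = 0) :
    ∀ m ≤ n, coeff m A = coeff m B := by
  intro m
  induction m using Nat.strong_induction_on with
  | _ m ih =>
    intro hm
    cases m with
    | zero => exact h0
    | succ m =>
      have a1 := congrArg (coeff (m + 1)) hA
      have b1 := congrArg (coeff (m + 1)) hB
      rw [coeff_succ_X_mul, coeff_derivative, coeff_mul] at a1 b1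
      have : (coeff (m + 1) A) * ((m : ℚ) + 1) = coeff (m + 1) B * ((m : ℚ) + 1) := by
        rw [a1, b1]
        apply Finset.sum_congr rfl
        rintro ⟨i, j⟩ hij
        rw [Finset.HasAntidiagonal.mem_antidiagonal] at hij
        simp only at hij ⊢
        rcases Nat.eq_zero_or_pos i with rfl | hi
        · rw [← hCD 0 (by omega), hC0]; simp
        · rw [hCD i (by omega), ih j (by omega) (by omega)]
      exact mul_right_cancel₀ (by positivity) this

open PowerSeries in
noncomputable def geoS (r : ℚ) : PowerSeries ℚ := PowerSeries.mk fun m => r ^ m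

open PowerSeries in
lemma geoS_mul (r : ℚ) : geoS r * (1 - C r * X) = 1 := by
  ext m
  rw [mul_sub, mul_one, mul_left_comm, map_sub, coeff_C_mul, coeff_one]
  cases m with
  | zero => simp [geoS]
  | succ m => rw [coeff_succ_mul_X]; simp [geoS, pow_succ']

open PowerSeries in
lemma evenS_mul (r : ℚ) :
    (PowerSeries.mk fun m => if 2 ∣ m then r ^ (m / 2) else 0) * (1 - C r * X ^ 2) = 1 := by
  ext m
  rw [mul_sub, mul_one, mul_left_comm, map_sub, coeff_C_mul, coeff_one, mul_comm _ (X ^ 2), coeff_X_pow_mul']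
  simp only [coeff_mk]
  rcases m with _ | _ | m
  · simp
  · simp
  · have h1 : (m + 1 + 1) / 2 = m / 2 + 1 := by omega
    have h2 : 2 ∣ m + 1 + 1 ↔ 2 ∣ m := by omega
    simp only [h1, h2]
    by_cases h : 2 ∣ m <;> simp [h, pow_succ']

open PowerSeries in
lemma linS_mul : (PowerSeries.mk fun m : ℕ => (m : ℚ) * (-1) ^ m) * (1 + X) ^ 2 = - X := by
  have h : X * derivative ℚ (geoS (-1)) = PowerSeries.mk fun m : ℕ => (m : ℚ) * (-1) ^ m := by
    ext m
    cases m with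
    | zero => simp
    | succ m => rw [coeff_succ_X_mul, coeff_derivative]; simp [geoS]; ring
  rw [← h]
  have g := geoS_mul (-1)
  have g' := congrArg (derivative ℚ) g
  simp at g' g
  linear_combination X * (1 + X) * g' - X * g

open PowerSeries in
lemma explicit_series (q : ℚ) (D B : PowerSeries ℚ)
    (hD : D = PowerSeries.mk fun m : ℕ => q ^ (2 * m) - (-1) ^ m * q ^ m + 2 * (-1) ^ m
      - 2 * (if 2 ∣ m then q ^ (m / 2) else 0))
    (hB : B = 1 + PowerSeries.mk fun n : ℕ => ((q - 1) / (q ^ 2 + 1) ^ 2) *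
        ((q ^ 3 + 2 * q ^ 2 + 2 * q + 1) * q ^ (2 * n) +
          (-1 : ℚ) ^ n *
            (((n : ℚ) - 1) * q ^ 3 - ((n : ℚ) + 2) * q ^ 2 +
              ((n : ℚ) - 2) * q - ((n : ℚ) + 1)))) :
    X * derivative ℚ B = D * B := by
  set e : ℚ := (q - 1) / (q ^ 2 + 1) ^ 2 with he
  have he' : e * (q ^ 2 + 1) ^ 2 = q - 1 := by
    rw [he]; field_simp
  have hE := evenS_mul q
  have hL := linS_mul
  set E : PowerSeries ℚ := PowerSeries.mk fun m => if 2 ∣ m then q ^ (m / 2) else 0 with hEd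
  set L : PowerSeries ℚ := PowerSeries.mk fun m : ℕ => (m : ℚ) * (-1) ^ m with hLd
  have g1 := geoS_mul (q ^ 2)
  have g2 := geoS_mul (-1)
  have g3 := geoS_mul (-q)
  have hD' : D = geoS (q ^ 2) - geoS (-q) + 2 * geoS (-1) - 2 * E := by
    have h2 : (2 : PowerSeries ℚ) = C 2 := (map_ofNat (C (R := ℚ)) 2).symm
    rw [hD, h2]
    ext m
    simp only [map_sub, map_add, coeff_C_mul, hEd, geoS, coeff_mk, pow_mul, neg_pow q m]
  have hB' : B = 1 + C e * ((C q ^ 3 + 2 * C q ^ 2 + 2 * C q + 1) * (geoS (q ^ 2) - geoS (-1)) +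
      ((C q - 1) * (C q ^ 2 + 1)) * L) := by
    have h2 : (C q ^ 3 + 2 * C q ^ 2 + 2 * C q + 1 : PowerSeries ℚ) = C (q ^ 3 + 2 * q ^ 2 + 2 * q + 1) := by
      have h2 : C 2 = (2 : PowerSeries ℚ) := map_ofNat (C (R := ℚ)) 2
      simp [h2]
    have h3 : ((C q - 1) * (C q ^ 2 + 1) : PowerSeries ℚ) = C ((q - 1) * (q ^ 2 + 1)) := by
      simp
    rw [hB, h2, h3]
    congr 1
    ext m
    rw [coeff_C_mul, map_add, coeff_C_mul, coeff_C_mul, map_sub]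
    simp only [hLd, geoS, coeff_mk, pow_mul]
    ring
  have hec : (C e * (C q ^ 2 + 1) ^ 2 : PowerSeries ℚ) = C q - 1 := by
    have := congrArg (C (R := ℚ)) he'
    simpa using this
  simp only [map_neg, map_pow, map_one] at g1 g2 g3
  generalize geoS (q ^ 2) = G1 at *
  generalize geoS (-1) = G2 at *
  generalize geoS (-q) = G3 at *
  clear_value E L
  have dc : derivative ℚ (C q) = 0 := by simp
  set c : PowerSeries ℚ := C q with hc
  set ee : PowerSeries ℚ := C e with hee
  have hBden : B * ((1 - c ^ 2 * X) * (1 + X) ^ 2) = (1 + c * X) * (1 - c * X ^ 2) := by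
    rw [hB']
    linear_combination ee * (c ^ 3 + 2 * c ^ 2 + 2 * c + 1) * (1 + X) ^ 2 * g1
      - ee * (c ^ 3 + 2 * c ^ 2 + 2 * c + 1) * (1 - c ^ 2 * X) * (1 + X) * g2
      + ee * ((c - 1) * (c ^ 2 + 1)) * (1 - c ^ 2 * X) * hL
      + X * ((c + 2) + (2 * c + 1) * X) * hec
  have hder := congrArg (derivative ℚ) hBden
  simp [dc, pow_two, Derivation.leibniz] at hder
  have hDP : D * ((1 - c ^ 2 * X) * (1 + c * X) * (1 + X) * (1 - c * X ^ 2)) =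
      (1 + c * X) * (1 + X) * (1 - c * X ^ 2) - (1 - c ^ 2 * X) * (1 + X) * (1 - c * X ^ 2)
      + 2 * ((1 - c ^ 2 * X) * (1 + c * X) * (1 - c * X ^ 2))
      - 2 * ((1 - c ^ 2 * X) * (1 + c * X) * (1 + X)) := by
    rw [hD']
    linear_combination (1 + c * X) * (1 + X) * (1 - c * X ^ 2) * g1
      - (1 - c ^ 2 * X) * (1 + X) * (1 - c * X ^ 2) * g3
      + 2 * ((1 - c ^ 2 * X) * (1 + c * X) * (1 - c * X ^ 2)) * g2
      - 2 * ((1 - c ^ 2 * X) * (1 + c * X) * (1 + X)) * hE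
  have hne : (1 - c ^ 2 * X) * (1 + c * X) * (1 + X) ^ 2 * (1 - c * X ^ 2) ≠ 0 := by
    intro h
    have := congrArg (coeff 0) h
    simp at this
  apply mul_right_cancel₀ hne
  linear_combination X * ((1 + c * X) * (1 - c * X ^ 2)) * hder
    - X * (c * (1 - c * X ^ 2) - 2 * c * X * (1 + c * X)) * hBden - B * (1 + X) * hDP

lemma nSet_eq {X : Type*} [DecidableEq X] (σ : X → X) (A : Set X) (U : Finset X) (n : ℕ)
    (hU : ∀ x, x ∈ U ↔ x ∈ A ∧ ∃ m, 0 < m ∧ m ≤ n ∧ Function.IsPeriodicPt σ m x) :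
    nSetCount σ A n = (stabF σ U n).card := by
  unfold nSetCount
  have h : {S : Set X | S ⊆ A ∧ S.Finite ∧ S.ncard = n ∧ σ '' S = S} =
      (fun S : Finset X => (S : Set X)) '' (stabF σ U n : Set (Finset X)) := by
    ext S
    simp only [Set.mem_ofPred_eq, Set.mem_image, stabF, Finset.coe_filter, Finset.mem_powerset]
    constructor
    · rintro ⟨h1, h2, h3, h4⟩
      lift S to Finset X using h2
      rw [Set.ncard_coe_finset] at h3
      have h5 : S.image σ = S := by
        apply Finset.coe_injective; rw [Finset.coe_image, h4]
      refine ⟨S, ⟨?_, h3, h5⟩, rfl⟩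
      intro x hx
      rw [hU]
      refine ⟨h1 hx, Function.minimalPeriod σ x, ?_, ?_, Function.isPeriodicPt_minimalPeriod σ x⟩
      · apply Function.minimalPeriod_pos_of_mem_periodicPts
        have hinj : Set.InjOn σ S := by
          apply Finset.card_image_iff.1; rw [h5]
        have hmaps : Set.MapsTo σ S S := fun y hy => by
          rw [← h4]; exact Set.mem_image_of_mem _ hy
        obtain ⟨m, hm, hp⟩ := Function.Injective.mem_periodicPts (hmaps.restrict_inj.2 hinj) ⟨x, hx⟩
        refine ⟨m, hm, ?_⟩
        have := congrArg Subtype.val hp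
        rwa [hmaps.iterate_restrict] at this
      · have : orbF σ x ⊆ S := by
          intro y hy
          obtain ⟨i, hi, rfl⟩ := mem_orbF hy
          exact stab_iter h5 hx i
        have := Finset.card_le_card this
        rwa [orbF_card, h3] at this
    · rintro ⟨S, ⟨h1, h2, h3⟩, rfl⟩
      refine ⟨fun x hx => ((hU x).1 (h1 hx)).1, S.finite_toSet, by rw [Set.ncard_coe_finset, h2], ?_⟩
      rw [← Finset.coe_image, h3]
  rw [h, Set.ncard_image_of_injective _ Finset.coe_injective, Set.ncard_coe_finset]

/-- Let `P₁, P₂, P₃ ∈ ℙ²(k̄)` be three distinct σ-fixed points and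
`X = ℙ²(k̄) \ {P₁, P₂, P₃}`.  For `n > 0`, the number of `n`-element
subsets `S ⊆ X` with `σ(S) = S` equals
`((q−1)/(q²+1)²)[(q³+2q²+2q+1)q^{2n} +
(−1)ⁿ((n−1)q³ − (n+2)q² + (n−2)q − (n+1))]`. -/
theorem stmt10 (k : Type*) [Field k] [Fintype k] (q n : ℕ)
    (hq : Fintype.card k = q) (hn : 0 < n)
    (P₁ P₂ P₃ : Projectivization (AlgebraicClosure k) (Fin 3 → AlgebraicClosure k))
    (h12 : P₁ ≠ P₂) (h13 : P₁ ≠ P₃) (h23 : P₂ ≠ P₃)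
    (hf1 : projFrob k 3 P₁ = P₁) (hf2 : projFrob k 3 P₂ = P₂)
    (hf3 : projFrob k 3 P₃ = P₃) :
    (nSetCount (projFrob k 3) ({P₁, P₂, P₃} : Set _)ᶜ n : ℚ) =
      (((q : ℚ) - 1) / ((q : ℚ) ^ 2 + 1) ^ 2) *
        (((q : ℚ) ^ 3 + 2 * (q : ℚ) ^ 2 + 2 * (q : ℚ) + 1) * (q : ℚ) ^ (2 * n) +
          (-1 : ℚ) ^ n *
            (((n : ℚ) - 1) * (q : ℚ) ^ 3 - ((n : ℚ) + 2) * (q : ℚ) ^ 2 +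
              ((n : ℚ) - 2) * (q : ℚ) - ((n : ℚ) + 1))) := by
  classical
  set σ := projFrob k 3 with hσ
  set T : Set (Projectivization (AlgebraicClosure k) (Fin 3 → AlgebraicClosure k)) := {P₁, P₂, P₃} with hT
  have hTfix : ∀ x ∈ T, σ x = x := by
    rintro x (rfl | rfl | rfl) <;> assumption
  have hTcard : T.ncard = 3 := Set.ncard_eq_three.2 ⟨_, _, _, h12, h13, h23, rfl⟩
  have hfin : {x | x ∈ Tᶜ ∧ ∃ m, 0 < m ∧ m ≤ n ∧ Function.IsPeriodicPt σ m x}.Finite := by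
    refine Set.Finite.subset (Set.Finite.biUnion (Set.finite_Icc 1 n)
      (fun m hm => (fix_count k m hm.1).1)) ?_
    rintro x ⟨-, m, h1, h2, h3⟩
    exact Set.mem_biUnion (show m ∈ Set.Icc 1 n from ⟨h1, h2⟩) h3
  set U := hfin.toFinset with hUdef
  have hU : ∀ x, x ∈ U ↔ x ∈ Tᶜ ∧ ∃ m, 0 < m ∧ m ≤ n ∧ Function.IsPeriodicPt σ m x := by
    intro x; rw [hUdef, Set.Finite.mem_toFinset, Set.mem_ofPred_eq]
  rw [nSet_eq σ Tᶜ U n hU]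
  have hper : ∀ x ∈ U, x ∈ Function.periodicPts σ := by
    intro x hx
    obtain ⟨-, m, h1, -, h3⟩ := (hU x).1 hx
    exact ⟨m, h1, h3⟩
  have hclosed : ∀ x ∈ U, σ x ∈ U := by
    intro x hx
    obtain ⟨h0, m, h1, h2, h3⟩ := (hU x).1 hx
    refine (hU _).2 ⟨?_, m, h1, h2, h3.apply⟩
    intro hc
    apply h0
    have h4 : Function.IsFixedPt σ (σ x) := hTfix _ hc
    have h5 : σ^[m - 1] (σ x) = x := by
      rw [← Function.iterate_succ_apply, Nat.succ_eq_add_one, Nat.sub_add_cancel h1]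
      exact h3
    rw [(h4.iterate (m - 1)).eq] at h5
    rwa [h5] at hc
  have hN : ∀ j, 0 < j → j ≤ n →
      ((U.filter (fun x => Function.minimalPeriod σ x ∣ j)).card : ℚ) =
      ((q : ℚ) ^ j) ^ 2 + (q : ℚ) ^ j - 2 := by
    intro j hj hjn
    obtain ⟨f1, f2⟩ := fix_count k j hj
    have e : ((U.filter (fun x => Function.minimalPeriod σ x ∣ j) : Finset _) : Set _) =
        {P | Function.IsPeriodicPt (projFrob k 3) j P} \ T := by
      ext x
      simp only [Finset.coe_filter, Set.mem_ofPred_eq, Set.mem_diff, hU,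
        ← Function.isPeriodicPt_iff_minimalPeriod_dvd]
      constructor
      · rintro ⟨⟨h, -⟩, h'⟩
        exact ⟨h', h⟩
      · rintro ⟨h', h⟩
        exact ⟨⟨h, j, hj, hjn, h'⟩, h'⟩
    have hsub : T ⊆ {P | Function.IsPeriodicPt (projFrob k 3) j P} := by
      intro x hx
      exact Function.IsFixedPt.isPeriodicPt (hTfix x hx) j
    have h := Set.ncard_diff_add_ncard_of_subset hsub f1
    rw [← e, Set.ncard_coe_finset, hTcard, f2, hq] at h
    have h' : ((U.filter (fun x => Function.minimalPeriod σ x ∣ j)).card : ℚ) + 3 =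
      ((q : ℚ) ^ j) ^ 2 + (q : ℚ) ^ j + 1 := by exact_mod_cast h
    linarith
  have hs := stab_series σ U hclosed hper _ rfl
  have hx := explicit_series q _ _ rfl rfl
  have hu := series_unique _ _ _ _ n ?_ hs hx ?_ ?_ n le_rfl
  · rw [PowerSeries.coeff_mk, map_add, PowerSeries.coeff_mk, PowerSeries.coeff_one, if_neg hn.ne', zero_add] at hu
    exact hu
  · have : stabF σ U 0 = {∅} := by
      ext S
      simp only [stabF, Finset.mem_filter, Finset.mem_powerset, Finset.mem_singleton, Finset.card_eq_zero]
      constructor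
      · exact fun h => h.2.1
      · rintro rfl; simp
    rw [PowerSeries.coeff_mk, map_add, PowerSeries.coeff_mk, this]
    simp
    right; ring
  · intro m hm
    rcases Nat.eq_zero_or_pos m with rfl | hm0
    · simp [Eser]
    · rw [Eser_sum σ U (fun j => ((q : ℚ) ^ j) ^ 2 + (q : ℚ) ^ j - 2) m hm0
        (fun j h1 h2 => hN j h1 (h2.trans hm)), PowerSeries.coeff_mk]
      rcases Nat.even_or_odd' m with ⟨r, rfl | rfl⟩
      · simp only [dvd_mul_right, if_true, Nat.mul_div_cancel_left _ two_pos]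
        rw [Even.neg_one_pow (even_two_mul r)]
        ring
      · have h2 : ¬ 2 ∣ 2 * r + 1 := by omega
        simp only [h2, if_false]
        rw [Odd.neg_one_pow ⟨r, rfl⟩]
        ring
  · simp [Eser]
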